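/- Let k ≥ 2 be an integer and let α_1 > α_2 > ... > α_k be real numbers. Then the pushforward of the product measure μ_{α_k} ⊗ ν_{α_k,α_{k-1}} ⊗ ν_{α_{k-1},α_{k-2}} ⊗ ... ⊗ ν_{α_2,α_1} under the map (t, s_1, ..., s_{k-1}) ↦ t · s_1 · ... · s_{k-1} equals μ_{α_1}. -/

import Mathlib

open MeasureTheory Real Set

/-- The Gamma-type measure `μ_β` on `(0,∞)` with density `t ↦ t^(-β-1) e^(-t)`. -/
noncomputable def gammaTypeMeasure (β : ℝ) : Measure ℝ :=
  (volume.restrict (Set.Ioi (0 : ℝ))).withDensity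
    (fun t => ENNReal.ofReal (t ^ (-β - 1) * Real.exp (-t)))

/-- The Beta-type measure `ν_{β,α}` on `(0,1)` with density
`s ↦ (Γ(α-β))⁻¹ (1-s)^(α-β-1) s^(-α-1)`. -/
noncomputable def betaTypeMeasure (β α : ℝ) : Measure ℝ :=
  (volume.restrict (Set.Ioo (0 : ℝ) 1)).withDensity
    (fun s => ENNReal.ofReal ((Real.Gamma (α - β))⁻¹ * (1 - s) ^ (α - β - 1) * s ^ (-α - 1)))

instance gammaTypeMeasure_sigmaFinite (β : ℝ) : SigmaFinite (gammaTypeMeasure β) := by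
  unfold gammaTypeMeasure
  exact SigmaFinite.withDensity_of_ne_top (by simp)

instance betaTypeMeasure_sigmaFinite (β α : ℝ) : SigmaFinite (betaTypeMeasure β α) := by
  unfold betaTypeMeasure
  exact SigmaFinite.withDensity_of_ne_top (by simp)

lemma lintegral_gammaType (β : ℝ) (f : ℝ → ENNReal) (hf : Measurable f) :
    ∫⁻ t, f t ∂(gammaTypeMeasure β) =
      ∫⁻ t in Ioi (0:ℝ), ENNReal.ofReal (t ^ (-β - 1) * Real.exp (-t)) * f t := by
  unfold gammaTypeMeasure
  rw [lintegral_withDensity_eq_lintegral_mul _ (by fun_prop) hf]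
  rfl

lemma lintegral_betaType (β α : ℝ) (f : ℝ → ENNReal) (hf : Measurable f) :
    ∫⁻ t, f t ∂(betaTypeMeasure β α) =
      ∫⁻ s in Ioo (0:ℝ) 1, ENNReal.ofReal ((Real.Gamma (α - β))⁻¹ * (1 - s) ^ (α - β - 1)
        * s ^ (-α - 1)) * f s := by
  unfold betaTypeMeasure
  rw [lintegral_withDensity_eq_lintegral_mul _ (by fun_prop) hf]
  rfl

lemma lintegral_scale (t : ℝ) (ht : 0 < t) (F : ℝ → ENNReal) (hF : Measurable F) :
    ∫⁻ s, F s = ∫⁻ x, ENNReal.ofReal t⁻¹ * F (x / t) := by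
  have h := Real.map_volume_mul_right (a := t⁻¹) (by positivity)
  rw [inv_inv, abs_of_pos ht] at h
  have h2 : ∫⁻ x, F (x / t) = ENNReal.ofReal t * ∫⁻ s, F s := by
    rw [← smul_eq_mul, ← lintegral_smul_measure, ← h, lintegral_map hF (by fun_prop)]
    rfl
  rw [lintegral_const_mul _ (by fun_prop), h2, ← mul_assoc, ← ENNReal.ofReal_mul (by positivity),
    inv_mul_cancel₀ ht.ne', ENNReal.ofReal_one, one_mul]

lemma lintegral_gamma_shift (c x : ℝ) (hc : 0 < c) :
    ∫⁻ t in Ioi x, ENNReal.ofReal (Real.exp (-t) * (t - x) ^ (c - 1)) =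
      ENNReal.ofReal (Real.exp (-x) * Real.Gamma c) := by
  have h1 : ∫⁻ t in Ioi (0:ℝ), ENNReal.ofReal (Real.exp (-t) * t ^ (c - 1)) =
      ENNReal.ofReal (Real.Gamma c) := by
    rw [Real.Gamma_eq_integral hc, ofReal_integral_eq_lintegral_ofReal
      (Real.GammaIntegral_convergent hc)]
    filter_upwards [ae_restrict_mem measurableSet_Ioi] with t ht
    have : (0:ℝ) < t := ht
    simp only [Pi.zero_apply]
    positivity
  rw [ENNReal.ofReal_mul (by positivity), ← h1, ← lintegral_const_mul _ (by fun_prop),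
    ← lintegral_indicator measurableSet_Ioi, ← lintegral_indicator measurableSet_Ioi,
    ← lintegral_add_right_eq_self _ x]
  congr 1 with t
  by_cases h : 0 < t
  · rw [indicator_of_mem (by simpa using h), indicator_of_mem (by simpa using h),
      ← ENNReal.ofReal_mul (by positivity), ← mul_assoc, ← Real.exp_add, add_sub_cancel_right,
      neg_add_rev]
  · rw [indicator_of_notMem (by simpa using h), indicator_of_notMem (by simpa using h)]

lemma density_identity (β α t x : ℝ) (hx : 0 < x) (hxt : x < t) :
    (t ^ (-β - 1) * Real.exp (-t)) * (t⁻¹ * ((Real.Gamma (α - β))⁻¹ *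
      (1 - x / t) ^ (α - β - 1) * (x / t) ^ (-α - 1))) =
    ((Real.Gamma (α - β))⁻¹ * x ^ (-α - 1)) * (Real.exp (-t) * (t - x) ^ (α - β - 1)) := by
  have ht : 0 < t := hx.trans hxt
  have e1 : 1 - x / t = (t - x) / t := by field_simp
  rw [e1, Real.div_rpow (sub_pos.2 hxt).le ht.le, Real.div_rpow hx.le ht.le]
  have e2 : t ^ (-β - 1) * t⁻¹ = t ^ (α - β - 1) * t ^ (-α - 1) := by
    rw [← Real.rpow_neg_one, ← Real.rpow_add ht, ← Real.rpow_add ht]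
    congr 1; ring
  have p1 : t ^ (α - β - 1) ≠ 0 := (Real.rpow_pos_of_pos ht _).ne'
  have p2 : t ^ (-α - 1) ≠ 0 := (Real.rpow_pos_of_pos ht _).ne'
  calc _ = (t ^ (-β - 1) * t⁻¹) / (t ^ (α - β - 1) * t ^ (-α - 1)) *
        (((Real.Gamma (α - β))⁻¹ * x ^ (-α - 1)) * (Real.exp (-t) * (t - x) ^ (α - β - 1))) := by
          generalize t ^ (-β - 1) = A
          generalize (Real.Gamma (α - β))⁻¹ = G
          field_simp
    _ = _ := by rw [e2, div_self (mul_ne_zero p1 p2), one_mul]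

lemma one_step (β α : ℝ) (h : β < α) (g : ℝ → ENNReal) (hg : Measurable g) :
    ∫⁻ t, ∫⁻ s, g (t * s) ∂(betaTypeMeasure β α) ∂(gammaTypeMeasure β) =
      ∫⁻ x, g x ∂(gammaTypeMeasure α) := by
  have hc : 0 < α - β := sub_pos.2 h
  have hG := Real.Gamma_pos_of_pos hc
  rw [lintegral_gammaType _ _ (Measurable.lintegral_prod_right' (f := fun p : ℝ × ℝ => g (p.1 * p.2))
    (by fun_prop)), lintegral_gammaType _ _ hg]
  -- the joint integrand after substitution
  let K : ℝ → ℝ → ENNReal := fun t x => ENNReal.ofReal (((Real.Gamma (α - β))⁻¹ * x ^ (-α - 1)) *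
    (Real.exp (-t) * (t - x) ^ (α - β - 1))) * g x
  let S : Set (ℝ × ℝ) := {p | 0 < p.2 ∧ p.2 < p.1}
  have hS : MeasurableSet S :=
    (measurableSet_lt measurable_const measurable_snd).inter
      (measurableSet_lt measurable_snd measurable_fst)
  have hKm : Measurable (S.indicator (fun p : ℝ × ℝ => K p.1 p.2)) := by
    apply Measurable.indicator _ hS
    simp only [K]
    fun_prop
  have step1 : ∫⁻ t in Ioi (0:ℝ), ENNReal.ofReal (t ^ (-β - 1) * Real.exp (-t)) *
      ∫⁻ s, g (t * s) ∂(betaTypeMeasure β α) =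
      ∫⁻ t, ∫⁻ x, S.indicator (fun p : ℝ × ℝ => K p.1 p.2) (t, x) := by
    rw [← lintegral_indicator measurableSet_Ioi]
    congr 1 with t
    by_cases ht : 0 < t
    · rw [indicator_of_mem (by simpa using ht), lintegral_betaType _ _ _ (by fun_prop),
        ← lintegral_indicator measurableSet_Ioo, lintegral_scale t ht _
          (Measurable.indicator (by fun_prop) measurableSet_Ioo),
        ← lintegral_const_mul]
      · congr 1 with x
        by_cases hx : 0 < x ∧ x < t
        · have hm : x / t ∈ Ioo (0:ℝ) 1 := ⟨div_pos hx.1 ht, (div_lt_one ht).2 hx.2⟩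
          rw [indicator_of_mem hm, indicator_of_mem (show (t, x) ∈ S from hx),
            mul_div_cancel₀ _ ht.ne', ← mul_assoc, ← mul_assoc, ← ENNReal.ofReal_mul, ← ENNReal.ofReal_mul,
            mul_assoc (t ^ (-β - 1) * Real.exp (-t)), density_identity β α t x hx.1 hx.2]
          all_goals positivity
        · have hm : x / t ∉ Ioo (0:ℝ) 1 := fun hh => hx
            ⟨(div_pos_iff_of_pos_right ht).1 hh.1, (div_lt_one ht).1 hh.2⟩
          rw [indicator_of_notMem hm, indicator_of_notMem (show (t, x) ∉ S from hx)]
          simp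
      · apply Measurable.const_mul
        exact (Measurable.indicator (by fun_prop) measurableSet_Ioo).comp
          (measurable_id.div_const t)
    · rw [indicator_of_notMem (by simpa using ht)]
      have : ∀ x, S.indicator (fun p : ℝ × ℝ => K p.1 p.2) (t, x) = 0 := fun x =>
        indicator_of_notMem (fun hh => ht (hh.1.trans hh.2)) _
      simp [this]
  rw [step1, lintegral_lintegral_swap (f := fun t x => S.indicator (fun p : ℝ × ℝ => K p.1 p.2) (t, x))
    hKm.aemeasurable, ← lintegral_indicator measurableSet_Ioi]
  congr 1 with x
  by_cases hx : 0 < x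
  · rw [indicator_of_mem (by simpa using hx)]
    have : ∀ t, S.indicator (fun p : ℝ × ℝ => K p.1 p.2) (t, x) =
        (Ioi x).indicator (fun t => (ENNReal.ofReal ((Real.Gamma (α - β))⁻¹ * x ^ (-α - 1)) * g x) *
          ENNReal.ofReal (Real.exp (-t) * (t - x) ^ (α - β - 1))) t := by
      intro t
      by_cases hxt : x < t
      · rw [indicator_of_mem (show (t, x) ∈ S from ⟨hx, hxt⟩), indicator_of_mem (by simpa using hxt)]
        simp only [K]
        rw [ENNReal.ofReal_mul (by positivity)]
        ring
      · rw [indicator_of_notMem (show (t, x) ∉ S from fun hh => hxt hh.2),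
          indicator_of_notMem (by simpa using hxt)]
    simp only [this]
    rw [lintegral_indicator measurableSet_Ioi, lintegral_const_mul _ (by fun_prop),
      lintegral_gamma_shift _ _ hc, mul_right_comm, ← ENNReal.ofReal_mul (by positivity)]
    congr 2
    field_simp
  · rw [indicator_of_notMem (by simpa using hx)]
    have : ∀ t, S.indicator (fun p : ℝ × ℝ => K p.1 p.2) (t, x) = 0 := fun t =>
      indicator_of_notMem (fun hh => hx hh.1) _
    simp [this]

lemma chain_lintegral (n : ℕ) : ∀ (α : Fin (n + 1) → ℝ), StrictAnti α →
    ∀ f : ℝ → ENNReal, Measurable f →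
    ∫⁻ t, ∫⁻ v, f (t * ∏ i, v i)
        ∂(Measure.pi fun i : Fin n => betaTypeMeasure (α i.succ) (α i.castSucc))
        ∂(gammaTypeMeasure (α (Fin.last n))) = ∫⁻ x, f x ∂(gammaTypeMeasure (α 0)) := by
  induction n with
  | zero =>
    intro α hα f hf
    simp
  | succ n ih =>
    intro α hα f hf
    have key : ∀ t : ℝ, ∫⁻ v, f (t * ∏ i, v i)
        ∂(Measure.pi fun i : Fin (n + 1) => betaTypeMeasure (α i.succ) (α i.castSucc)) =
        ∫⁻ s, (fun y => ∫⁻ w, f (y * ∏ i, w i)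
          ∂(Measure.pi fun i : Fin n => betaTypeMeasure (α i.succ.castSucc) (α i.castSucc.castSucc)))
            (t * s)
          ∂(betaTypeMeasure (α (Fin.last n).succ) (α (Fin.last n).castSucc)) := by
      intro t
      have mp := (measurePreserving_piFinSuccAbove
        (fun i : Fin (n + 1) => betaTypeMeasure (α i.succ) (α i.castSucc)) (Fin.last n)).symm
      rw [← mp.lintegral_comp (by fun_prop), lintegral_prod _ (by
        apply Measurable.aemeasurable
        exact (by fun_prop : Measurable fun v : Fin (n+1) → ℝ => f (t * ∏ i, v i)).comp
          (MeasurableEquiv.measurable _))]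
      simp only [Fin.succAbove_last, Fin.succ_castSucc]
      congr 1 with s
      congr 1 with w
      congr 1
      rw [Fin.prod_univ_castSucc]
      simp [MeasurableEquiv.piFinSuccAbove]
      ring
    simp only [key]
    have hm : Measurable (fun y => ∫⁻ w, f (y * ∏ i, w i)
          ∂(Measure.pi fun i : Fin n =>
            betaTypeMeasure (α i.succ.castSucc) (α i.castSucc.castSucc))) :=
      Measurable.lintegral_prod_right' (f := fun p : ℝ × (Fin n → ℝ) => f (p.1 * ∏ i, p.2 i))
        (by fun_prop)
    have := one_step (α (Fin.last n).succ) (α (Fin.last n).castSucc)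
      (hα (by simp [Fin.lt_def])) _ hm
    rw [Fin.succ_last] at this ⊢
    rw [this]
    exact ih (fun i => α i.castSucc) (fun i j hij => hα (by simpa using hij)) f hf

/-- Corollary 1(b): with `k = n + 1 ≥ 2` reals `α 0 > α 1 > ... > α n`, the pushforward of
`μ_{α n} ⊗ ν_{α 1, α 0} ⊗ ν_{α 2, α 1} ⊗ ... ⊗ ν_{α n, α (n-1)}` under multiplication of
all coordinates is `μ_{α 0}`. -/
theorem gammaType_pushforward_prod_chain (n : ℕ) (hn : 1 ≤ n) (α : Fin (n + 1) → ℝ)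
    (hα : StrictAnti α) :
    Measure.map (fun p : ℝ × (Fin n → ℝ) => p.1 * ∏ i, p.2 i)
        ((gammaTypeMeasure (α (Fin.last n))).prod
          (Measure.pi fun i : Fin n => betaTypeMeasure (α i.succ) (α i.castSucc)))
      = gammaTypeMeasure (α 0) := by
  ext A hA
  have hm : Measurable (fun p : ℝ × (Fin n → ℝ) => p.1 * ∏ i, p.2 i) := by fun_prop
  have hA1 : Measurable (A.indicator (1 : ℝ → ENNReal)) := measurable_one.indicator hA
  rw [← lintegral_indicator_one hA, ← lintegral_indicator_one hA, lintegral_map hA1 hm]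
  exact (lintegral_prod _ (hA1.comp hm).aemeasurable).trans (chain_lintegral n α hα _ hA1)
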